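/- Every regular elliptic conjugacy class contains a product of two hyperbolic isometries in any prescribed hyperbolic classes: let r₁, r₂ be real numbers with r₁ > 1 and r₂ > 1, and let θ₁, θ₂ ∈ (0, 2π) with θ₁ ≠ θ₂. Let E = diag(e^{i(2θ₁−θ₂)/3}, e^{i(2θ₂−θ₁)/3}, e^{−i(θ₁+θ₂)/3}) (the lift of the regular elliptic class with angle pair {θ₁,θ₂}). Then there exist matrices A, B with Aᴴ J A = J and Bᴴ J B = J, whose characteristic polynomials are (X − r₁)(X − 1)(X − 1/r₁) and (X − r₂)(X − 1)(X − 1/r₂) respectively, a matrix P with Pᴴ J P = J, and a scalar ω ∈ ℂ with ω³ = 1, such that A · B · (P E P⁻¹) = ω · 1. -/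

import Mathlib

open Matrix Polynomial

/-- The Hermitian form of signature (2,1) on ℂ³ (ball model). -/
noncomputable def Jball : Matrix (Fin 3) (Fin 3) ℂ := Matrix.diagonal ![1, 1, -1]

/-- Membership in U(2,1). -/
def InU21 (A : Matrix (Fin 3) (Fin 3) ℂ) : Prop := Aᴴ * Jball * A = Jball

theorem InU21.mul {A B : Matrix (Fin 3) (Fin 3) ℂ} (hA : InU21 A) (hB : InU21 B) :
    InU21 (A * B) := by
  unfold InU21 at *
  calc (A * B)ᴴ * Jball * (A * B) = Bᴴ * (Aᴴ * Jball * A) * B := by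
        rw [conjTranspose_mul]; simp only [Matrix.mul_assoc]
    _ = Jball := by rw [hA, hB]

theorem InU21.smul {A : Matrix (Fin 3) (Fin 3) ℂ} (hA : InU21 A) {z : ℂ} (hz : ‖z‖ = 1) :
    InU21 (z • A) := by
  unfold InU21 at *
  rw [conjTranspose_smul, smul_mul_assoc, smul_mul_smul_comm, hA, Complex.star_def,
    Complex.conj_mul', hz]
  simp

theorem inU21_one : InU21 1 := by simp [InU21]

theorem inU21_diagonal {a b c : ℂ} (ha : ‖a‖ = 1) (hb : ‖b‖ = 1) (hc : ‖c‖ = 1) :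
    InU21 (diagonal ![a, b, c]) := by
  have key : ∀ z : ℂ, ‖z‖ = 1 → (starRingEnd ℂ) z * z = 1 := fun z hz => by
    rw [Complex.conj_mul', hz]; simp
  unfold InU21 Jball
  rw [diagonal_conjTranspose, diagonal_mul_diagonal, diagonal_mul_diagonal]
  congr 1
  ext i
  fin_cases i <;> simp [key, ha, hb, hc]

/-- A matrix of `SU(2,1)` satisfies `adj M = J Mᴴ J`, so its trace determines its
characteristic polynomial. -/
theorem InU21.charpoly_eq {M : Matrix (Fin 3) (Fin 3) ℂ} (hM : InU21 M) (hdet : M.det = 1)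
    {s : ℝ} (hs : s ≠ 0) (htr : M.trace = 1 + s + 1 / s) :
    M.charpoly = (X - C (s : ℂ)) * (X - C 1) * (X - C (1 / (s : ℂ))) := by
  have hs' : (s : ℂ) ≠ 0 := by exact_mod_cast hs
  have hJ : Jball * Jball = 1 := by
    unfold Jball
    rw [diagonal_mul_diagonal, ← diagonal_one]
    congr 1
    ext i
    fin_cases i <;> simp
  have hinv : (Jball * Mᴴ * Jball) * M = 1 := by
    unfold InU21 at hM
    rw [Matrix.mul_assoc, Matrix.mul_assoc, ← Matrix.mul_assoc Mᴴ, hM, hJ]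
  have hadj : M.adjugate = Jball * Mᴴ * Jball := by
    have h := M.mul_adjugate
    rw [hdet, one_smul] at h
    calc M.adjugate = (Jball * Mᴴ * Jball) * M * M.adjugate := by rw [hinv, Matrix.one_mul]
      _ = _ := by rw [Matrix.mul_assoc, h, Matrix.mul_one]
  have htadj : M.adjugate.trace = 1 + s + 1 / s := by
    rw [hadj, trace_mul_cycle, hJ, Matrix.one_mul, trace_conjTranspose, htr]
    simp
  have hexp : M.charpoly
      = X ^ 3 - C M.trace * X ^ 2 + C M.adjugate.trace * X - C M.det := by
    rw [charpoly, det_fin_three, det_fin_three, adjugate_fin_three]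
    simp [trace_fin_three]
    ring
  have hC : (C (s : ℂ) : ℂ[X]) * C (1 / (s : ℂ)) = 1 := by
    rw [← C_mul, mul_one_div_cancel hs', C_1]
  rw [hexp, htr, htadj, hdet]
  simp only [C_add, C_1]
  linear_combination (1 - X) * hC

/-- The matrix `1 + (ρ - 1) p qᴴ J + (σ - 1) q pᴴ J` for the null vectors `p = (0, 1, 1)` and
`q = (m, v, v - 1)`, where `w` is the conjugate of `v`. -/
def hyperbolicMatrix (ρ σ w v m : ℂ) : Matrix (Fin 3) (Fin 3) ℂ :=
  !![1, (σ - 1) * m, -(σ - 1) * m;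
     (ρ - 1) * m, 1 + (ρ - 1) * w + (σ - 1) * v, (ρ - 1) * (1 - w) - (σ - 1) * v;
     (ρ - 1) * m, (ρ - 1) * w + (σ - 1) * (v - 1), 1 + (ρ - 1) * (1 - w) + (σ - 1) * (1 - v)]

section hyperbolicMatrix

variable {ρ σ w v m : ℂ}

theorem hyperbolicMatrix_mul_swap (h : ρ * σ = 1) (hm : m ^ 2 = 1 - w - v) :
    hyperbolicMatrix σ ρ w v m * hyperbolicMatrix ρ σ w v m = 1 := by
  ext i j
  fin_cases i <;> fin_cases j <;>
    simp [hyperbolicMatrix, Matrix.mul_apply, Fin.sum_univ_three] <;> grind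

theorem det_hyperbolicMatrix (h : ρ * σ = 1) :
    (hyperbolicMatrix ρ σ w v m).det = 1 := by
  rw [det_fin_three]
  simp [hyperbolicMatrix]
  grind

theorem trace_hyperbolicMatrix : (hyperbolicMatrix ρ σ w v m).trace = 1 + ρ + σ := by
  simp [hyperbolicMatrix, trace_fin_three]
  ring

theorem inU21_hyperbolicMatrix (h : ρ * σ = 1) (hm : m ^ 2 = 1 - w - v)
    (hρ : (starRingEnd ℂ) ρ = ρ) (hσ : (starRingEnd ℂ) σ = σ) (hm' : (starRingEnd ℂ) m = m)
    (hw : (starRingEnd ℂ) w = v) (hv : (starRingEnd ℂ) v = w) :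
    InU21 (hyperbolicMatrix ρ σ w v m) := by
  unfold InU21 Jball
  ext i j
  fin_cases i <;> fin_cases j <;>
    simp [hyperbolicMatrix, Matrix.mul_apply, Fin.sum_univ_three, diagonal_apply,
      hρ, hσ, hm', hw, hv] <;> grind

end hyperbolicMatrix

theorem exists_cube_root_re_mul_le (z : ℂ) : ∃ ω : ℂ, ω ^ 3 = 1 ∧ (ω * z).re ≤ -‖z‖ / 2 := by
  have h3 : √3 * √3 = (3 : ℝ) := Real.mul_self_sqrt (by norm_num)
  have hR : ‖z‖ ^ 2 = z.re ^ 2 + z.im ^ 2 := by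
    rw [Complex.sq_norm, Complex.normSq_apply]; ring
  have hR0 := norm_nonneg z
  by_cases h1 : z.re ≤ -‖z‖ / 2
  · exact ⟨1, by simp, by simpa using h1⟩
  have main : ∀ t : ℝ, t ^ 2 = 3 → 0 ≤ t * z.im → ‖z‖ ≤ z.re + t * z.im := by
    intro t ht h0
    by_contra! hlt
    have hsq : (t * z.im) ^ 2 = 3 * (‖z‖ - z.re) * (‖z‖ + z.re) := by
      linear_combination z.im ^ 2 * ht - 3 * hR
    nlinarith
  have cube : ∀ t : ℝ, t ^ 2 = 3 → (⟨-1 / 2, -t / 2⟩ : ℂ) ^ 3 = 1 := by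
    intro t ht
    apply Complex.ext <;> simp [pow_succ]
    · linear_combination (3 / 8) * ht
    · linear_combination (t / 8) * ht
  have fin : ∀ t : ℝ, t ^ 2 = 3 → 0 ≤ t * z.im →
      ∃ ω : ℂ, ω ^ 3 = 1 ∧ (ω * z).re ≤ -‖z‖ / 2 := by
    intro t ht h0
    refine ⟨⟨-1 / 2, t / 2⟩, by simpa using cube (-t) (by simpa using ht), ?_⟩
    have := main t ht h0
    simp only [Complex.mul_re]
    linarith
  rcases le_total 0 z.im with h | h
  · exact fin √3 (by linarith [h3]) (by positivity)
  · exact fin (-√3) (by linarith [h3]) (mul_nonneg_of_nonpos_of_nonpos (by simp) h)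

/-- Every value of the trace required below is attained with a parameter `w` of real part at
most `1 / 2`. -/
theorem exists_trace_parameter {r τ : ℝ} (hr : 1 < r) (hτ : 2 ≤ τ) {a b c : ℂ}
    (ha : ‖a‖ = 1) (hb : ‖b‖ = 1) (hc : ‖c‖ = 1) (hbc : b ≠ c) :
    ∃ ω w : ℂ, ω ^ 3 = 1 ∧ w.re ≤ 1 / 2 ∧
      a + b * (1 + (r - 1) * w + (1 / r - 1) * (starRingEnd ℂ) w)
        + c * (1 + (r - 1) * (1 - w) + (1 / r - 1) * (1 - (starRingEnd ℂ) w)) = ω * τ := by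
  have hr0 : 0 < r := by linarith
  have hd : b - c ≠ 0 := sub_ne_zero.2 hbc
  have hdn : 0 < ‖b - c‖ := norm_pos_iff.2 hd
  obtain ⟨ω, hω, hle⟩ := exists_cube_root_re_mul_le ((starRingEnd ℂ) (b - c))
  rw [Complex.norm_conj] at hle
  set k : ℝ := r + 1 / r - 2 with hk
  set l : ℝ := r - 1 / r with hl
  have hk0 : 0 < k := by
    have : k = (r - 1) ^ 2 / r := by rw [hk]; field_simp; ring
    rw [this]
    have : 0 < r - 1 := by linarith
    positivity
  have hl0 : 0 < l := by
    have : 1 / r < 1 := by rw [div_lt_one hr0]; exact hr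
    linarith
  set W : ℂ := (ω * τ - (a + b + c + k * c)) / (b - c) with hW
  have hWd : W * (b - c) = ω * τ - (a + b + c + k * c) := div_mul_cancel₀ _ hd
  have hWre : W.re ≤ k / 2 := by
    have e1 : W * (‖b - c‖ ^ 2 : ℝ)
        = (ω * τ - (a + b + c + k * c)) * (starRingEnd ℂ) (b - c) := by
      rw [← hWd, mul_assoc, Complex.mul_conj']
      push_cast; rfl
    have e2 := congrArg Complex.re e1
    rw [Complex.re_mul_ofReal] at e2
    have e3 : -‖b - c‖ ≤ (a * (starRingEnd ℂ) (b - c)).re := by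
      have := Complex.abs_re_le_norm (a * (starRingEnd ℂ) (b - c))
      rw [norm_mul, ha, one_mul, Complex.norm_conj] at this
      exact (abs_le.1 this).1
    have nb : b.re ^ 2 + b.im ^ 2 = 1 := by
      have := Complex.sq_norm b
      rw [hb, Complex.normSq_apply] at this; linarith
    have nc : c.re ^ 2 + c.im ^ 2 = 1 := by
      have := Complex.sq_norm c
      rw [hc, Complex.normSq_apply] at this; linarith
    have nd : ‖b - c‖ ^ 2 = (b.re - c.re) ^ 2 + (b.im - c.im) ^ 2 := by
      rw [Complex.sq_norm, Complex.normSq_apply]; simp; ring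
    have e4 : (W.re - k / 2) * ‖b - c‖ ^ 2
        = τ * (ω * (starRingEnd ℂ) (b - c)).re - (a * (starRingEnd ℂ) (b - c)).re := by
      rw [sub_mul, e2, nd]
      simp
      linear_combination (-1 - k / 2) * nb + (1 + k / 2) * nc
    have e5 : (W.re - k / 2) * ‖b - c‖ ^ 2 ≤ 0 := by
      rw [e4]
      nlinarith
    by_contra! hlt
    have : 0 < (W.re - k / 2) * ‖b - c‖ ^ 2 := by
      have : 0 < W.re - k / 2 := by linarith
      positivity
    linarith
  refine ⟨ω, ⟨W.re / k, W.im / l⟩, hω, ?_, ?_⟩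
  · change W.re / k ≤ 1 / 2
    rw [div_le_iff₀ hk0]; linarith
  · have key : ((r : ℂ) - 1) * ⟨W.re / k, W.im / l⟩
        + (1 / r - 1) * (starRingEnd ℂ) ⟨W.re / k, W.im / l⟩ = W := by
      have : ((1 / r : ℝ) : ℂ) = 1 / (r : ℂ) := by push_cast; rfl
      rw [← this]
      apply Complex.ext
      · simp only [Complex.add_re, Complex.mul_re, Complex.sub_re, Complex.sub_im,
          Complex.ofReal_re, Complex.ofReal_im, Complex.one_re, Complex.one_im,
          Complex.conj_re, Complex.conj_im]
        have h := div_mul_cancel₀ W.re hk0.ne'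
        rw [hk] at h
        linear_combination h
      · simp only [Complex.add_im, Complex.mul_im, Complex.sub_re, Complex.sub_im,
          Complex.ofReal_re, Complex.ofReal_im, Complex.one_re, Complex.one_im,
          Complex.conj_re, Complex.conj_im]
        have h := div_mul_cancel₀ W.im hl0.ne'
        rw [hl] at h
        linear_combination h
    have hkc : (k : ℂ) = r + 1 / r - 2 := by rw [hk]; push_cast; rfl
    rw [hkc] at hWd
    linear_combination (b - c) * key + hWd

/-- Every regular elliptic conjugacy class contains a product of two hyperbolic
isometries in any prescribed hyperbolic classes. -/
theorem regular_elliptic_product_two_hyperbolic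
    (r₁ r₂ : ℝ) (hr₁ : 1 < r₁) (hr₂ : 1 < r₂)
    (θ₁ θ₂ : ℝ) (hθ₁ : 0 < θ₁) (hθ₁' : θ₁ < 2 * Real.pi)
    (hθ₂ : 0 < θ₂) (hθ₂' : θ₂ < 2 * Real.pi) (hne : θ₁ ≠ θ₂) :
    ∃ (A B P : Matrix (Fin 3) (Fin 3) ℂ) (ω : ℂ),
      InU21 A ∧ InU21 B ∧ InU21 P ∧ ω ^ 3 = 1 ∧
      A.charpoly = (X - C ((r₁ : ℂ))) * (X - C 1) * (X - C (1 / (r₁ : ℂ))) ∧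
      B.charpoly = (X - C ((r₂ : ℂ))) * (X - C 1) * (X - C (1 / (r₂ : ℂ))) ∧
      A * B * (P * Matrix.diagonal
        ![Complex.exp (((2 * θ₁ - θ₂ : ℝ) : ℂ) * Complex.I / 3),
          Complex.exp (((2 * θ₂ - θ₁ : ℝ) : ℂ) * Complex.I / 3),
          Complex.exp (-(((θ₁ + θ₂ : ℝ) : ℂ) * Complex.I / 3))] * P⁻¹)
        = ω • (1 : Matrix (Fin 3) (Fin 3) ℂ) := by
  have norm_exp : ∀ t : ℝ, ‖Complex.exp ((t : ℂ) * Complex.I)‖ = 1 :=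
    Complex.norm_exp_ofReal_mul_I
  have hr₁0 : (r₁ : ℂ) ≠ 0 := by exact_mod_cast (by linarith : r₁ ≠ 0)
  set α : ℝ := (2 * θ₁ - θ₂) / 3 with hα
  set β : ℝ := (2 * θ₂ - θ₁) / 3 with hβ
  set γ : ℝ := -(θ₁ + θ₂) / 3 with hγ
  have eα : ((2 * θ₁ - θ₂ : ℝ) : ℂ) * Complex.I / 3 = (α : ℂ) * Complex.I := by
    rw [hα]; push_cast; ring
  have eβ : ((2 * θ₂ - θ₁ : ℝ) : ℂ) * Complex.I / 3 = (β : ℂ) * Complex.I := by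
    rw [hβ]; push_cast; ring
  have eγ : -(((θ₁ + θ₂ : ℝ) : ℂ) * Complex.I / 3) = (γ : ℂ) * Complex.I := by
    rw [hγ]; push_cast; ring
  rw [eα, eβ, eγ]
  have hbc : Complex.exp (((-β : ℝ) : ℂ) * Complex.I)
      ≠ Complex.exp (((-γ : ℝ) : ℂ) * Complex.I) := by
    intro h
    obtain ⟨n, hn⟩ := Complex.exp_eq_exp_iff_exists_int.1 h
    have h1 : -β = -γ + n * (2 * Real.pi) := by
      have := congrArg Complex.im hn
      simpa using this
    have h2 : θ₂ = -n * (2 * Real.pi) := by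
      rw [hβ, hγ] at h1; linarith
    have hpi := Real.pi_pos
    have h3 : (0 : ℝ) < -n := by
      by_contra! h0
      nlinarith
    have h4 : (-n : ℝ) < 1 := by
      by_contra! h0
      nlinarith
    have h5 : 0 < -n := by exact_mod_cast h3
    have h6 : -n < 1 := by exact_mod_cast h4
    omega
  have hτ : 2 ≤ 1 + r₂ + 1 / r₂ := by
    have : 0 < 1 / r₂ := by positivity
    linarith
  obtain ⟨ω, w, hω, hw, htr⟩ := exists_trace_parameter hr₁ hτ (norm_exp (-α)) (norm_exp (-β))
    (norm_exp (-γ)) hbc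
  have hωn : ‖ω‖ = 1 := Complex.norm_eq_one_of_pow_eq_one hω (by norm_num)
  have hm : ((√(1 - 2 * w.re) : ℝ) : ℂ) ^ 2 = 1 - w - (starRingEnd ℂ) w := by
    rw [← Complex.ofReal_pow, Real.sq_sqrt (by linarith), sub_sub, Complex.add_conj]
    push_cast; ring
  generalize √(1 - 2 * w.re) = m at hm
  set D : Matrix (Fin 3) (Fin 3) ℂ := diagonal ![Complex.exp (((-α : ℝ) : ℂ) * Complex.I),
    Complex.exp (((-β : ℝ) : ℂ) * Complex.I), Complex.exp (((-γ : ℝ) : ℂ) * Complex.I)] with hD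
  set G := hyperbolicMatrix r₁ (1 / r₁) w ((starRingEnd ℂ) w) m with hG
  have h1 : (r₁ : ℂ) * (1 / r₁) = 1 := mul_one_div_cancel hr₁0
  have h2 : 1 / (r₁ : ℂ) * r₁ = 1 := one_div_mul_cancel hr₁0
  have hA : InU21 (hyperbolicMatrix (1 / r₁) r₁ w ((starRingEnd ℂ) w) m) :=
    inU21_hyperbolicMatrix h2 hm (by simp) (by simp) (by simp) rfl (by simp)
  have hGU : InU21 G :=
    inU21_hyperbolicMatrix h1 hm (by simp) (by simp) (by simp) rfl (by simp)
  have hDU : InU21 D := inU21_diagonal (norm_exp _) (norm_exp _) (norm_exp _)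
  have hB : InU21 (ω ^ 2 • (G * D)) := (hGU.mul hDU).smul (by simp [hωn])
  have hDdet : D.det = 1 := by
    rw [hD, det_diagonal, Fin.prod_univ_three]
    simp only [cons_val]
    rw [← Complex.exp_add, ← Complex.exp_add, Complex.exp_eq_one_iff]
    refine ⟨0, ?_⟩
    rw [hα, hβ, hγ]
    push_cast; ring
  refine ⟨_, _, 1, ω ^ 2, hA, hB, inU21_one, by rw [← pow_mul, mul_comm, pow_mul, hω, one_pow],
    hA.charpoly_eq (det_hyperbolicMatrix h2) (by linarith) ?_,
    hB.charpoly_eq ?_ (by linarith) ?_, ?_⟩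
  · rw [trace_hyperbolicMatrix]; ring
  · rw [det_smul, det_mul, det_hyperbolicMatrix h1, hDdet, Fintype.card_fin]
    linear_combination (ω ^ 3 + 1) * hω
  · have : (G * D).trace = ω * ((1 + r₂ + 1 / r₂ : ℝ) : ℂ) := by
      rw [← htr, trace_fin_three, hD, mul_diagonal, mul_diagonal, mul_diagonal]
      simp [hG, hyperbolicMatrix]
      ring
    rw [trace_smul, this, smul_eq_mul, ← mul_assoc, ← pow_succ, hω]
    push_cast; ring
  · have hDE : D * diagonal ![Complex.exp ((α : ℂ) * Complex.I),
        Complex.exp ((β : ℂ) * Complex.I), Complex.exp ((γ : ℂ) * Complex.I)] = 1 := by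
      rw [hD, diagonal_mul_diagonal, ← diagonal_one]
      congr 1
      ext i
      fin_cases i <;> simp [← Complex.exp_add]
    rw [inv_one, Matrix.one_mul, Matrix.mul_one, mul_smul_comm, smul_mul_assoc,
      ← Matrix.mul_assoc, hG, hyperbolicMatrix_mul_swap h1 hm, Matrix.one_mul, hDE]
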